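/- arXiv:2208.08828 — 2 statements merged into one kernel-verified Lean document; each statement's English description precedes it below -/
import Mathlib

section
/- Let (A_i)_{i∈S} and (B_i)_{i∈S} be families of nonzero commutative rings, let φ_i : A_i → B_i be ring homomorphisms for each i ∈ S, and let φ : ∏_{i∈S} A_i → ∏_{i∈S} B_i be the induced product ring homomorphism, φ((a_i)_i) = (φ_i(a_i))_i. Then a prime ideal P of ∏_{i∈S} B_i is a wild prime if and only if φ^{-1}(P) is a wild prime of ∏_{i∈S} A_i. -/
/-- A prime ideal of a direct product ring `Π i, R i` is *tame* if it is the preimage of a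
prime ideal of one of the factors under the projection map. -/
def IsTamePrime {S : Type*} (R : S → Type*) [∀ i, CommRing (R i)]
    (P : Ideal (Π i, R i)) : Prop :=
  ∃ (k : S) (p : Ideal (R k)), p.IsPrime ∧ P = p.comap (Pi.evalRingHom R k)

/-- A prime ideal of a direct product ring is *wild* if it is not tame. -/
def IsWildPrime {S : Type*} (R : S → Type*) [∀ i, CommRing (R i)]
    (P : Ideal (Π i, R i)) : Prop :=
  P.IsPrime ∧ ¬ IsTamePrime R P

theorem isTamePrime_iff_exists_single_notMem {S : Type*} [DecidableEq S] (R : S → Type*)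
    [∀ i, CommRing (R i)] {P : Ideal (Π i, R i)} (hP : P.IsPrime) :
    IsTamePrime R P ↔ ∃ k, (Pi.single k 1 : Π i, R i) ∉ P := by
  constructor
  · rintro ⟨k, p, hp, rfl⟩
    refine ⟨k, fun h => hp.ne_top ?_⟩
    rw [Ideal.eq_top_iff_one]
    simpa using h
  · rintro ⟨k, hk⟩
    have hsurj : Function.Surjective (Pi.evalRingHom R k) := Function.surjective_eval k
    have hker : RingHom.ker (Pi.evalRingHom R k) ≤ P := by
      intro x hx
      have hxk : x k = 0 := hx
      have hmul : x * Pi.single k 1 = 0 := by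
        rw [← Pi.single_mul_right, hxk, zero_mul, Pi.single_zero]
      exact (hP.mem_or_mem (hmul ▸ P.zero_mem)).resolve_right hk
    refine ⟨k, P.map (Pi.evalRingHom R k), Ideal.map_isPrime_of_surjective hsurj hker, ?_⟩
    rw [Ideal.comap_map_of_surjective' _ hsurj, sup_eq_left.mpr hker]

/-- For a family of ring homomorphisms `φ i : A i → B i` inducing
`φ : Π i, A i → Π i, B i`, a prime ideal `P` of `Π i, B i` is wild iff `φ⁻¹(P)` is a wild
prime of `Π i, A i`. -/
theorem isWildPrime_comap_iff {S : Type*} (A B : S → Type*)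
    [∀ i, CommRing (A i)] [∀ i, Nontrivial (A i)]
    [∀ i, CommRing (B i)] [∀ i, Nontrivial (B i)]
    (φ : ∀ i, A i →+* B i) (P : Ideal (Π i, B i)) (hP : P.IsPrime) :
    IsWildPrime B P ↔
      IsWildPrime A (P.comap (Pi.ringHom fun i => (φ i).comp (Pi.evalRingHom A i))) := by
  classical
  have hP' := hP.comap (Pi.ringHom fun i => (φ i).comp (Pi.evalRingHom A i))
  have hsingle (k : S) : Pi.ringHom (fun i => (φ i).comp (Pi.evalRingHom A i))
      (Pi.single k 1) = Pi.single k 1 := by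
    ext i
    exact (Pi.apply_single (fun i => φ i) (fun i => map_zero (φ i)) k 1 i).trans (by rw [map_one])
  simp only [IsWildPrime, hP, hP', true_and, isTamePrime_iff_exists_single_notMem B hP,
    isTamePrime_iff_exists_single_notMem A hP', Ideal.mem_comap, hsingle]
end

section
/- Let (R_k)_{k∈S} be a family of integral domains indexed by an infinite set S and let R = ∏_{k∈S} R_k. Then the set of minimal wild primes of R (prime ideals of R that are both minimal primes of R and wild) has cardinality exactly 2^(2^|S|). -/
universe u

open Classical in
/-- An infinite set `S` carries an independent family of subsets indexed by the subsets of `S`: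
every prescribed finite pattern of memberships is realized by a point. -/
theorem exists_independent_family (S : Type u) [Infinite S] :
    ∃ X : Set S → Set S, ∀ (T : Finset (Set S)) (𝒜 : Set (Set S)),
      ∃ s : S, ∀ A ∈ T, s ∈ X A ↔ A ∈ 𝒜 := by
  have hcard : Cardinal.mk S = Cardinal.mk (Finset S × Finset (Finset S)) := by
    simp
  obtain ⟨e⟩ := Cardinal.eq.1 hcard
  refine ⟨fun A => {s | (e s).1.filter (· ∈ A) ∈ (e s).2}, fun T 𝒜 => ?_⟩
  have hsep : ∀ A B : Set S, ∃ x, A ≠ B → ¬(x ∈ A ↔ x ∈ B) := by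
    intro A B
    by_cases h : A = B
    · exact ⟨Classical.arbitrary S, fun h' => (h' h).elim⟩
    · by_contra! hc
      exact h (Set.ext fun x => (hc x).2)
  choose d hd using hsep
  let F : Finset S := (T ×ˢ T).image fun p => d p.1 p.2
  refine ⟨e.symm (F, (T.filter (· ∈ 𝒜)).image fun A => F.filter (· ∈ A)), fun A hA => ?_⟩
  simp only [Set.mem_ofPred_eq, Equiv.apply_symm_apply, Finset.mem_image, Finset.mem_filter]
  refine ⟨?_, fun h => ⟨A, ⟨hA, h⟩, rfl⟩⟩
  rintro ⟨B, ⟨hB, hB𝒜⟩, hBA⟩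
  by_cases h : B = A
  · exact h ▸ hB𝒜
  · have hF : d B A ∈ F := Finset.mem_image.2 ⟨(B, A), Finset.mk_mem_product hB hA, rfl⟩
    have := Finset.ext_iff.1 hBA (d B A)
    simp only [Finset.mem_filter, hF, true_and] at this
    exact (hd B A h this).elim

/-- There are at most `2 ^ (2 ^ |S|)` ultrafilters on `S`. -/
theorem mk_ultrafilter_le (S : Type u) :
    Cardinal.mk (Ultrafilter S) ≤ (2 : Cardinal.{u}) ^ ((2 : Cardinal.{u}) ^ Cardinal.mk S) := by
  rw [← Cardinal.mk_set, ← Cardinal.mk_set]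
  refine Cardinal.mk_le_of_injective (f := fun U : Ultrafilter S => {s : Set S | s ∈ U}) ?_
  intro U V h
  exact Ultrafilter.ext fun s => Set.ext_iff.1 h s

open Classical in
/-- Pospíšil's theorem: there are `2 ^ (2 ^ |S|)` ultrafilters on an infinite set `S`. -/
theorem mk_ultrafilter (S : Type u) [Infinite S] :
    Cardinal.mk (Ultrafilter S) = (2 : Cardinal.{u}) ^ ((2 : Cardinal.{u}) ^ Cardinal.mk S) := by
  refine (mk_ultrafilter_le S).antisymm ?_
  obtain ⟨X, hX⟩ := exists_independent_family S
  have hU : ∀ 𝒜 : Set (Set S), ∃ U : Ultrafilter S, ∀ A, X A ∈ U ↔ A ∈ 𝒜 := by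
    intro 𝒜
    let g : Set S → Set S := fun A => if A ∈ 𝒜 then X A else (X A)ᶜ
    have hne : (Filter.generate (Set.range g)).NeBot := by
      refine Filter.generate_neBot_iff.2 fun t ht htf => ?_
      lift t to Finset (Set S) using htf
      rw [← Set.image_univ] at ht
      obtain ⟨T, -, rfl⟩ := Finset.subset_set_image_iff.1 ht
      obtain ⟨s, hs⟩ := hX T 𝒜
      refine ⟨s, ?_⟩
      simp only [Finset.coe_image, Set.sInter_image, Set.mem_iInter]
      intro A hA
      have := hs A hA
      by_cases h : A ∈ 𝒜 <;> simp_all [g]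
    refine ⟨Ultrafilter.of (Filter.generate (Set.range g)), fun A => ?_⟩
    have hg : g A ∈ Ultrafilter.of (Filter.generate (Set.range g)) :=
      Ultrafilter.of_le _ (Filter.mem_generate_of_mem ⟨A, rfl⟩)
    by_cases h : A ∈ 𝒜
    · simpa [g, h] using hg
    · simpa only [g, h, if_false, Ultrafilter.compl_mem_iff_notMem, iff_false] using hg
  choose U hU using hU
  rw [← Cardinal.mk_set, ← Cardinal.mk_set]
  refine Cardinal.mk_le_of_injective (f := U) fun 𝒜 ℬ h => Set.ext fun A => ?_
  rw [← hU 𝒜, h, hU]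

/-- There are `2 ^ (2 ^ |S|)` nonprincipal ultrafilters on an infinite set `S`. -/
theorem mk_nonprincipal_ultrafilter (S : Type u) [Infinite S] :
    Cardinal.mk ↥(Set.range (pure : S → Ultrafilter S))ᶜ =
      (2 : Cardinal.{u}) ^ ((2 : Cardinal.{u}) ^ Cardinal.mk S) := by
  have : Infinite (Ultrafilter S) := Infinite.of_injective _ Ultrafilter.pure_injective
  rw [Cardinal.mk_compl_of_infinite, mk_ultrafilter]
  rw [mk_ultrafilter]
  exact Cardinal.mk_range_le.trans_lt ((Cardinal.cantor _).trans (Cardinal.cantor _))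

section UltrafilterIdeal

variable {S : Type*} (R : S → Type*) [∀ k, CommRing (R k)]

/-- The ideal of the families vanishing on a set belonging to the ultrafilter `U`. -/
def ultrafilterIdeal (U : Ultrafilter S) : Ideal (Π k, R k) where
  carrier := {r | {k | r k = 0} ∈ U}
  add_mem' {a b} ha hb := by
    filter_upwards [ha, hb] with k (hk : a k = 0) (hk' : b k = 0)
    simp [hk, hk']
  zero_mem' := by filter_upwards with k using rfl
  smul_mem' c r hr := by
    filter_upwards [hr] with k (hk : r k = 0)
    simp [hk]

variable {R}

theorem mem_ultrafilterIdeal {U : Ultrafilter S} {r : Π k, R k} :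
    r ∈ ultrafilterIdeal R U ↔ {k | r k = 0} ∈ U := Iff.rfl

variable (R)

open Classical in
/-- The idempotent of the product ring supported on `A`. -/
noncomputable def indicatorOne (A : Set S) : Π k, R k := fun k => if k ∈ A then 1 else 0

variable {R}

theorem indicatorOne_mul_compl (A : Set S) :
    indicatorOne R A * indicatorOne R Aᶜ = 0 := by
  ext k
  by_cases h : k ∈ A <;> simp [indicatorOne, h]

theorem indicatorOne_add_compl (A : Set S) :
    indicatorOne R A + indicatorOne R Aᶜ = 1 := by
  ext k
  by_cases h : k ∈ A <;> simp [indicatorOne, h]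

theorem indicatorOne_mul_eq_zero (r : Π k, R k) :
    indicatorOne R {k | r k = 0} * r = 0 := by
  ext k
  by_cases h : r k = 0 <;> simp [indicatorOne, h]

theorem indicatorOne_compl_mul (r : Π k, R k) :
    indicatorOne R {k | r k = 0}ᶜ * r = r := by
  ext k
  by_cases h : r k = 0 <;> simp [indicatorOne, h]

theorem ultrafilterIdeal_le_of_isPrime (Q : Ideal (Π k, R k)) [Q.IsPrime] :
    ∃ U : Ultrafilter S, ultrafilterIdeal R U ≤ Q := by
  let f : Filter S :=
    { sets := {A | indicatorOne R Aᶜ ∈ Q}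
      univ_sets := by
        have : indicatorOne R (Set.univᶜ : Set S) = 0 := by ext; simp [indicatorOne]
        simp [-Set.compl_univ, this]
      sets_of_superset := by
        intro A B (hA : _ ∈ Q) hAB
        have : indicatorOne R Bᶜ = indicatorOne R Bᶜ * indicatorOne R Aᶜ := by
          ext k
          by_cases h : k ∈ A
          · simp [indicatorOne, h, hAB h]
          · simp [indicatorOne, h]
        change _ ∈ Q
        rw [this]
        exact Q.mul_mem_left _ hA
      inter_sets := by
        intro A B (hA : _ ∈ Q) (hB : _ ∈ Q)
        have : indicatorOne R (A ∩ B)ᶜ =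
            indicatorOne R Aᶜ + indicatorOne R A * indicatorOne R Bᶜ := by
          ext k
          by_cases h : k ∈ A <;> by_cases h' : k ∈ B <;> simp [indicatorOne, h, h']
        change _ ∈ Q
        rw [this]
        exact Q.add_mem hA (Q.mul_mem_left _ hB) }
  have hf : ∀ A, A ∈ f ↔ indicatorOne R Aᶜ ∈ Q := fun _ => Iff.rfl
  refine ⟨Ultrafilter.ofComplNotMemIff f fun A => ?_, fun r hr => ?_⟩
  · rw [hf, hf, compl_compl]
    refine ⟨fun h => ?_, fun h h' => ?_⟩
    · exact (Ideal.IsPrime.mem_or_mem ‹_›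
        ((indicatorOne_mul_compl (R := R) A).symm ▸ Q.zero_mem)).resolve_left h
    · exact Ideal.IsPrime.ne_top ‹_› ((Ideal.eq_top_iff_one Q).2
        (indicatorOne_add_compl (R := R) A ▸ Q.add_mem h' h))
  · have : indicatorOne R {k | r k = 0}ᶜ ∈ Q := hr
    rw [← indicatorOne_compl_mul r]
    exact Q.mul_mem_right _ this

variable [∀ k, Nontrivial (R k)]

theorem indicatorOne_mem_ultrafilterIdeal {U : Ultrafilter S} {A : Set S} :
    indicatorOne R A ∈ ultrafilterIdeal R U ↔ Aᶜ ∈ U := by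
  have : {k | indicatorOne R A k = 0} = Aᶜ := by
    ext k
    by_cases h : k ∈ A <;> simp [indicatorOne, h]
  rw [mem_ultrafilterIdeal, this]

variable (R) in
theorem ultrafilterIdeal_injective : Function.Injective (ultrafilterIdeal R) := by
  intro U V h
  refine Ultrafilter.ext fun A => ?_
  rw [← compl_compl A, ← indicatorOne_mem_ultrafilterIdeal (R := R), h,
    indicatorOne_mem_ultrafilterIdeal]

theorem isWildPrime_ultrafilterIdeal {U : Ultrafilter S} (hU : U ∉ Set.range pure)
    (hP : (ultrafilterIdeal R U).IsPrime) : IsWildPrime R (ultrafilterIdeal R U) := by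
  refine ⟨hP, ?_⟩
  rintro ⟨k, p, -, h⟩
  have hk : indicatorOne R {k}ᶜ ∈ ultrafilterIdeal R U := by
    rw [h, Ideal.mem_comap]
    simp [indicatorOne]
  rw [indicatorOne_mem_ultrafilterIdeal, compl_compl] at hk
  exact hU ⟨k, Ultrafilter.coe_le_coe.1 (by simpa using hk) |>.symm⟩

end UltrafilterIdeal

section IsDomain

variable {S : Type*} (R : S → Type*) [∀ k, CommRing (R k)] [∀ k, IsDomain (R k)]

instance isPrime_ultrafilterIdeal (U : Ultrafilter S) : (ultrafilterIdeal R U).IsPrime := by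
  refine ⟨fun h => ?_, fun {a b} hab => ?_⟩
  · have h1 := (Ideal.eq_top_iff_one _).1 h
    simp [mem_ultrafilterIdeal] at h1
  · simp only [mem_ultrafilterIdeal] at hab ⊢
    rw [← Ultrafilter.union_mem_iff]
    convert hab using 1
    ext k
    simp

theorem ultrafilterIdeal_mem_minimalPrimes (U : Ultrafilter S) :
    ultrafilterIdeal R U ∈ minimalPrimes (Π k, R k) := by
  refine ⟨⟨inferInstance, bot_le⟩, fun Q hQ hQU r hr => ?_⟩
  have hmem : indicatorOne R {k | r k = 0} * r ∈ Q :=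
    (indicatorOne_mul_eq_zero r).symm ▸ Q.zero_mem
  refine (hQ.1.mem_or_mem hmem).resolve_left fun h => ?_
  exact Ultrafilter.compl_mem_iff_notMem.1 (indicatorOne_mem_ultrafilterIdeal.1 (hQU h)) hr

/-- The minimal primes of a product of integral domains are the ideals `ultrafilterIdeal R U`. -/
theorem minimalPrimes_pi_eq_range :
    minimalPrimes (Π k, R k) = Set.range (ultrafilterIdeal R) := by
  refine Set.Subset.antisymm (fun P hP => ?_) ?_
  · have := hP.1.1
    obtain ⟨U, hU⟩ := ultrafilterIdeal_le_of_isPrime P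
    exact ⟨U, hU.antisymm (hP.2 ⟨inferInstance, bot_le⟩ hU)⟩
  · rintro _ ⟨U, rfl⟩
    exact ultrafilterIdeal_mem_minimalPrimes R U

end IsDomain

/-- If `S` is infinite and each `R k` is an integral domain, then the set of minimal wild
primes of `R = Π k, R k` has cardinality `2 ^ (2 ^ |S|)`. -/
theorem card_minimal_wildPrimes {S : Type u} (R : S → Type u) [Infinite S]
    [∀ k, CommRing (R k)] [∀ k, IsDomain (R k)] :
    Cardinal.mk {P : Ideal (Π k, R k) //
        P ∈ minimalPrimes (Π k, R k) ∧ IsWildPrime R P} =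
      (2 : Cardinal.{u}) ^ ((2 : Cardinal.{u}) ^ Cardinal.mk S) := by
  apply le_antisymm
  · refine (Cardinal.mk_subtype_mono (q := (· ∈ minimalPrimes (Π k, R k))) fun P h => h.1).trans ?_
    change Cardinal.mk ↥(minimalPrimes (Π k, R k)) ≤ _
    rw [minimalPrimes_pi_eq_range]
    exact Cardinal.mk_range_le.trans (mk_ultrafilter_le S)
  · rw [← mk_nonprincipal_ultrafilter S]
    refine Cardinal.mk_le_of_injective (f := fun U : ↥(Set.range (pure : S → Ultrafilter S))ᶜ =>
      ⟨ultrafilterIdeal R U.1,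
      ultrafilterIdeal_mem_minimalPrimes R U.1,
      isWildPrime_ultrafilterIdeal U.2 inferInstance⟩) fun U V h => ?_
    exact Subtype.ext (ultrafilterIdeal_injective R (congrArg Subtype.val h))
end
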